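/- There exist absolute constants C₃, c₀ > 0 such that the following holds. Let m ≥ 2 and d ≥ c₀·log m be integers, and let x_1,…,x_m be independent random vectors uniform on the unit sphere of ℝ^d. Fix indices i, j, a set T ⊆ {1,…,m} with |T| ≤ d, and an injection σ : T → {1,…,m} such that the indices in T ∪ σ(T) ∪ {i, j} make all the vectors appearing below distinct, i.e., σ(T) ∩ T = ∅ and i, j ∉ T ∪ σ(T). Then P[ |Σ_{a∈T} ⟨x_i, x_{σ(a)}⟩·⟨x_j, x_a⟩| > C₃·√(log m / d) ] ≤ 2·m^{−6}. -/

import Mathlib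

open MeasureTheory ProbabilityTheory

/-- The uniform distribution on the unit sphere of `ℝ^d`, realized as the pushforward of
the standard Gaussian on `ℝ^d` under radial normalization `g ↦ g / ‖g‖₂`. -/
noncomputable def uniformSphere (d : ℕ) : Measure (Fin d → ℝ) :=
  (Measure.pi fun _ : Fin d => gaussianReal 0 1).map
    fun g => (Real.sqrt (∑ r, g r ^ 2))⁻¹ • g

theorem lintegral_pi_prod_eq_prod {ι : Type*} [Fintype ι] {E : Type*} [MeasurableSpace E]
    (μ : Measure E) [IsProbabilityMeasure μ] (f : ι → E → ENNReal) (hf : ∀ i, Measurable (f i)) :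
    ∫⁻ g : ι → E, ∏ i, f i (g i) ∂(Measure.pi fun _ => μ) = ∏ i, ∫⁻ x, f i x ∂μ := by
  have h := lintegral_prod_eq_prod_lintegral_of_indepFun (μ := Measure.pi fun _ : ι => μ)
    Finset.univ (fun i g => f i (g i)) (iIndepFun_pi fun i => (hf i).aemeasurable)
    fun i => (hf i).comp (measurable_pi_apply i)
  rw [h]
  refine Finset.prod_congr rfl fun i _ => ?_
  exact (measurePreserving_eval (fun _ : ι => μ) i).lintegral_comp (hf i)

theorem pi_withDensity_prod {ι : Type*} [Fintype ι] {E : Type*} [MeasurableSpace E]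
    (μ : Measure E) [IsProbabilityMeasure μ] (f : E → ENNReal) (hf : Measurable f)
    [SigmaFinite (μ.withDensity f)] :
    (Measure.pi fun _ : ι => μ).withDensity (fun g => ∏ i, f (g i)) =
      Measure.pi fun _ : ι => μ.withDensity f := by
  symm
  refine Measure.pi_eq fun s hs => ?_
  rw [withDensity_apply _ (MeasurableSet.univ_pi hs),
    ← lintegral_indicator (MeasurableSet.univ_pi hs)]
  simp_rw [withDensity_apply _ (hs _), ← lintegral_indicator (hs _)]
  rw [← lintegral_pi_prod_eq_prod μ _ fun i => hf.indicator (hs i)]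
  congr 1 with g
  by_cases hg : g ∈ Set.univ.pi s
  · simp only [Set.indicator_of_mem hg]
    exact Finset.prod_congr rfl fun i _ => (Set.indicator_of_mem (hg i trivial) _).symm
  · rw [Set.indicator_of_notMem hg]
    obtain ⟨i, hi⟩ : ∃ i, g i ∉ s i := by simpa [Set.mem_pi] using hg
    exact (Finset.prod_eq_zero (Finset.mem_univ i) (Set.indicator_of_notMem hi _)).symm

theorem gaussianReal_withDensity_exp_neg_sq :
    (gaussianReal 0 1).withDensity
        (fun x => ENNReal.ofReal (Real.sqrt 2 * Real.exp (-x ^ 2 / 2))) =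
      (gaussianReal 0 1).map (fun x => (Real.sqrt 2)⁻¹ * x) := by
  rw [gaussianReal_map_const_mul, gaussianReal_of_var_ne_zero _ one_ne_zero,
    gaussianReal_of_var_ne_zero, ← withDensity_mul _ (by fun_prop) (by fun_prop)]
  · congr 1 with x
    simp only [Pi.mul_apply, gaussianPDF, gaussianPDFReal]
    rw [← ENNReal.ofReal_mul (by positivity)]
    congr 1
    have h2 : Real.sqrt 2 ^ 2 = 2 := Real.sq_sqrt (by norm_num)
    have h3 : ((Real.sqrt 2)⁻¹) ^ 2 = 1 / 2 := by rw [inv_pow, h2]; norm_num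
    simp only [NNReal.coe_one, mul_one, NNReal.coe_mk, mul_zero, sub_zero, h3]
    rw [show 2 * Real.pi * (1 / 2) = Real.pi by ring, Real.sqrt_mul (by norm_num)]
    have : Real.sqrt 2 ≠ 0 := by positivity
    have : Real.sqrt Real.pi ≠ 0 := by positivity
    field_simp
    rw [← Real.exp_nat_mul]
    congr 1
    push_cast
    ring
  · simp [← NNReal.coe_ne_zero]

theorem lintegral_pi_gaussianReal_mul_prod_exp {ι : Type*} [Fintype ι]
    {F : (ι → ℝ) → ENNReal} (hF : Measurable F)
    (hscale : ∀ c : ℝ, 0 < c → ∀ g, F (c • g) = F g) :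
    ∫⁻ g, (∏ i, ENNReal.ofReal (Real.sqrt 2 * Real.exp (-g i ^ 2 / 2))) * F g
        ∂(Measure.pi fun _ : ι => gaussianReal 0 1) =
      ∫⁻ g, F g ∂(Measure.pi fun _ : ι => gaussianReal 0 1) := by
  have hm : Measurable (fun x : ℝ => ENNReal.ofReal (Real.sqrt 2 * Real.exp (-x ^ 2 / 2))) := by
    fun_prop
  have : IsProbabilityMeasure ((gaussianReal 0 1).map (fun x => (Real.sqrt 2)⁻¹ * x)) :=
    Measure.isProbabilityMeasure_map (by fun_prop)
  have : SigmaFinite ((gaussianReal 0 1).withDensity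
      (fun x => ENNReal.ofReal (Real.sqrt 2 * Real.exp (-x ^ 2 / 2)))) := by
    rw [gaussianReal_withDensity_exp_neg_sq]; infer_instance
  have h := pi_withDensity_prod (ι := ι) (gaussianReal 0 1) _ hm
  refine (lintegral_withDensity_eq_lintegral_mul _ (by fun_prop) hF).symm.trans ?_
  rw [h]
  simp_rw [gaussianReal_withDensity_exp_neg_sq]
  rw [← Measure.pi_map_pi (fun _ => by fun_prop), lintegral_map hF (by fun_prop)]
  exact lintegral_congr fun g => hscale _ (by positivity) g

theorem lintegral_pi_gaussianReal_le_six_mul {ι : Type*} [Fintype ι] [Nonempty ι]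
    {F : (ι → ℝ) → ENNReal} (hF : Measurable F)
    (hscale : ∀ c : ℝ, 0 < c → ∀ g, F (c • g) = F g)
    (hfin : ∫⁻ g, F g ∂(Measure.pi fun _ : ι => gaussianReal 0 1) ≠ ⊤) :
    ∫⁻ g, F g ∂(Measure.pi fun _ : ι => gaussianReal 0 1) ≤
      6 * ∫⁻ g in {g | (Fintype.card ι : ℝ) / 4 ≤ ∑ i, g i ^ 2}, F g
        ∂(Measure.pi fun _ : ι => gaussianReal 0 1) := by
  set γ := Measure.pi fun _ : ι => gaussianReal 0 1
  set S : Set (ι → ℝ) := {g | (Fintype.card ι : ℝ) / 4 ≤ ∑ i, g i ^ 2}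
  have hS : MeasurableSet S := measurableSet_le (by fun_prop) (by fun_prop)
  have hq : Real.exp (1 / 8) * (Real.sqrt 2)⁻¹ ≤ 5 / 6 := by
    have h1 : Real.exp (1 / 8) ^ 2 ≤ 25 / 18 := by
      rw [← Real.exp_nat_mul]
      have h4 : Real.exp (((2 : ℕ) : ℝ) * (1 / 8)) ^ 4 ≤ (25 / 18) ^ 4 := by
        rw [← Real.exp_nat_mul]
        have := Real.exp_one_lt_d9
        norm_num at this ⊢
        linarith
      exact le_of_pow_le_pow_left₀ (by norm_num) (by norm_num) h4
    have h2 : (Real.sqrt 2)⁻¹ ^ 2 = 1 / 2 := by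
      rw [inv_pow, Real.sq_sqrt (by norm_num)]; norm_num
    refine le_of_pow_le_pow_left₀ two_ne_zero (by norm_num) ?_
    rw [mul_pow, h2]
    linarith
  have hpt : ∀ g, F g ≤ S.indicator F g + ENNReal.ofReal (5 / 6) *
      ((∏ i, ENNReal.ofReal (Real.sqrt 2 * Real.exp (-g i ^ 2 / 2))) * F g) := by
    intro g
    by_cases hg : g ∈ S
    · rw [Set.indicator_of_mem hg]; exact le_self_add
    · rw [Set.indicator_of_notMem hg, zero_add, ← mul_assoc]
      refine le_mul_of_one_le_left' ?_
      rw [← ENNReal.ofReal_prod_of_nonneg (fun i _ => by positivity),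
        ← ENNReal.ofReal_mul (by norm_num), ENNReal.one_le_ofReal]
      have hg' : ∑ i, g i ^ 2 < (Fintype.card ι : ℝ) / 4 := not_le.1 hg
      calc (1 : ℝ) ≤ ∏ i, Real.exp (1 / 8 + -g i ^ 2 / 2) := by
            rw [← Real.exp_sum, Real.one_le_exp_iff, Finset.sum_add_distrib]
            simp only [Finset.sum_const, Finset.card_univ, nsmul_eq_mul, neg_div,
              Finset.sum_neg_distrib, ← Finset.sum_div]
            linarith
        _ = (Real.exp (1 / 8) * (Real.sqrt 2)⁻¹) ^ Fintype.card ι *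
              ∏ i, (Real.sqrt 2 * Real.exp (-g i ^ 2 / 2)) := by
            rw [← Finset.card_univ, ← Finset.prod_const, ← Finset.prod_mul_distrib]
            refine Finset.prod_congr rfl fun i _ => ?_
            have : Real.sqrt 2 ≠ 0 := by positivity
            rw [Real.exp_add]
            field_simp
        _ ≤ _ := by
            gcongr
            calc _ ≤ (5 / 6 : ℝ) ^ Fintype.card ι := by gcongr
              _ ≤ 5 / 6 := pow_le_of_le_one (by norm_num) (by norm_num) Fintype.card_ne_zero
  have hI : ∫⁻ g, F g ∂γ ≤ ∫⁻ g in S, F g ∂γ + ENNReal.ofReal (5 / 6) * ∫⁻ g, F g ∂γ := by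
    calc _ ≤ _ := lintegral_mono hpt
      _ = _ := by
        rw [lintegral_add_left (hF.indicator hS), lintegral_indicator hS,
          lintegral_const_mul _ (by fun_prop),
          lintegral_pi_gaussianReal_mul_prod_exp hF hscale]
  by_cases hA : ∫⁻ g in S, F g ∂γ = ⊤
  · simp [hA]
  lift (∫⁻ g in S, F g ∂γ) to NNReal using hA with A
  lift (∫⁻ g, F g ∂γ) to NNReal using hfin with I
  have h : (I : ℝ) ≤ A + 5 / 6 * I := by
    have := ENNReal.toReal_mono (by finiteness) hI
    rw [ENNReal.toReal_add (by finiteness) (by finiteness), ENNReal.toReal_mul,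
      ENNReal.toReal_ofReal (by norm_num)] at this
    simpa using this
  have h' : I ≤ 6 * A := by
    rw [← NNReal.coe_le_coe]; push_cast; linarith
  exact_mod_cast h'

/-- Radial normalization `g ↦ g / ‖g‖₂`, sending `0` to `0`. -/
noncomputable def radialNormalize {ι : Type*} [Fintype ι] (g : ι → ℝ) : ι → ℝ :=
  (Real.sqrt (∑ r, g r ^ 2))⁻¹ • g

@[fun_prop]
theorem measurable_radialNormalize {ι : Type*} [Fintype ι] :
    Measurable (radialNormalize : (ι → ℝ) → ι → ℝ) := by
  unfold radialNormalize
  fun_prop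

theorem radialNormalize_smul {ι : Type*} [Fintype ι] {c : ℝ} (hc : 0 < c) (g : ι → ℝ) :
    radialNormalize (c • g) = radialNormalize g := by
  have h : Real.sqrt (∑ r, (c • g) r ^ 2) = c * Real.sqrt (∑ r, g r ^ 2) := by
    simp_rw [Pi.smul_apply, smul_eq_mul, mul_pow]
    rw [← Finset.mul_sum, Real.sqrt_mul (by positivity), Real.sqrt_sq hc.le]
  unfold radialNormalize
  rw [h, smul_smul]
  congr 1
  field_simp

theorem radialNormalize_neg {ι : Type*} [Fintype ι] (g : ι → ℝ) :
    radialNormalize (-g) = -radialNormalize g := by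
  simp [radialNormalize]

theorem sum_sq_radialNormalize_le_one {ι : Type*} [Fintype ι] (g : ι → ℝ) :
    ∑ r, radialNormalize g r ^ 2 ≤ 1 := by
  have h : 0 ≤ ∑ r, g r ^ 2 := by positivity
  simp_rw [radialNormalize, Pi.smul_apply, smul_eq_mul, mul_pow]
  rw [← Finset.mul_sum, inv_pow, Real.sq_sqrt h]
  exact inv_mul_le_one

theorem abs_sum_mul_le_one {ι : Type*} [Fintype ι] {u v : ι → ℝ}
    (hu : ∑ r, u r ^ 2 ≤ 1) (hv : ∑ r, v r ^ 2 ≤ 1) : |∑ r, u r * v r| ≤ 1 := by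
  rw [← sq_le_one_iff_abs_le_one]
  calc _ ≤ (∑ r, u r ^ 2) * ∑ r, v r ^ 2 := Finset.sum_mul_sq_le_sq_mul_sq _ _ _
    _ ≤ 1 := mul_le_one₀ hu (by positivity) hv

theorem lintegral_cosh_radialNormalize_le {ι : Type*} [Fintype ι] [Nonempty ι]
    {u : ι → ℝ} (hu : ∑ r, u r ^ 2 ≤ 1) (a : ℝ) :
    ∫⁻ g, ENNReal.ofReal (Real.cosh (a * ∑ r, u r * radialNormalize g r) - 1)
        ∂(Measure.pi fun _ : ι => gaussianReal 0 1) ≤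
      6 * ∫⁻ g, ENNReal.ofReal
          (Real.cosh (2 * a / Real.sqrt (Fintype.card ι) * ∑ r, u r * g r) - 1)
        ∂(Measure.pi fun _ : ι => gaussianReal 0 1) := by
  refine (lintegral_pi_gaussianReal_le_six_mul (by fun_prop)
    (fun c hc g => by rw [radialNormalize_smul hc]) ?_).trans ?_
  · refine ne_top_of_le_ne_top (b := ENNReal.ofReal (Real.cosh a - 1)) (by finiteness) ?_
    calc _ ≤ ∫⁻ _, ENNReal.ofReal (Real.cosh a - 1)
          ∂(Measure.pi fun _ : ι => gaussianReal 0 1) := by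
            refine lintegral_mono fun g => ENNReal.ofReal_le_ofReal ?_
            gcongr
            rw [Real.cosh_le_cosh, abs_mul]
            exact mul_le_of_le_one_right (abs_nonneg _)
              (abs_sum_mul_le_one hu (sum_sq_radialNormalize_le_one g))
      _ = _ := by simp
  · gcongr 6 * ?_
    have hS : MeasurableSet {g : ι → ℝ | (Fintype.card ι : ℝ) / 4 ≤ ∑ i, g i ^ 2} :=
      measurableSet_le (by fun_prop) (by fun_prop)
    refine (setLIntegral_mono' hS fun g hg => ?_).trans (setLIntegral_le_lintegral _ _)
    refine ENNReal.ofReal_le_ofReal ?_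
    gcongr
    rw [Real.cosh_le_cosh]
    have hd : 0 < Real.sqrt (Fintype.card ι) := by
      rw [Real.sqrt_pos]; exact_mod_cast Fintype.card_pos
    have h1 : Real.sqrt (Fintype.card ι) / 2 ≤ Real.sqrt (∑ r, g r ^ 2) := by
      refine Real.le_sqrt_of_sq_le ?_
      rw [div_pow, Real.sq_sqrt (by positivity)]
      norm_num
      exact hg
    have h2 : (Real.sqrt (∑ r, g r ^ 2))⁻¹ ≤ 2 / Real.sqrt (Fintype.card ι) := by
      rw [← inv_div]
      exact inv_anti₀ (by positivity) h1
    have h3 : ∑ r, u r * radialNormalize g r =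
        (Real.sqrt (∑ r, g r ^ 2))⁻¹ * ∑ r, u r * g r := by
      rw [Finset.mul_sum]
      refine Finset.sum_congr rfl fun r _ => ?_
      simp only [radialNormalize, Pi.smul_apply, smul_eq_mul]
      ring
    rw [h3, ← mul_assoc, abs_mul, abs_mul _ (∑ r, u r * g r)]
    gcongr ?_ * _
    rw [abs_mul, abs_of_nonneg (by positivity : 0 ≤ (Real.sqrt (∑ r, g r ^ 2))⁻¹), abs_div,
      abs_mul, abs_two, abs_of_pos hd]
    calc _ ≤ |a| * (2 / Real.sqrt (Fintype.card ι)) := by gcongr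
      _ = _ := by ring

theorem lintegral_exp_sum_mul_pi_gaussianReal {ι : Type*} [Fintype ι] (u : ι → ℝ) (a : ℝ) :
    ∫⁻ g, ENNReal.ofReal (Real.exp (a * ∑ r, u r * g r))
        ∂(Measure.pi fun _ : ι => gaussianReal 0 1) =
      ENNReal.ofReal (Real.exp (a ^ 2 * (∑ r, u r ^ 2) / 2)) := by
  have h1 : ∀ g : ι → ℝ, ENNReal.ofReal (Real.exp (a * ∑ r, u r * g r)) =
      ∏ r, ENNReal.ofReal (Real.exp (a * u r * g r)) := by
    intro g
    rw [← ENNReal.ofReal_prod_of_nonneg (fun i _ => by positivity), ← Real.exp_sum,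
      Finset.mul_sum]
    simp_rw [mul_assoc]
  have h2 : ∀ t : ℝ, ∫⁻ x, ENNReal.ofReal (Real.exp (t * x)) ∂(gaussianReal 0 1) =
      ENNReal.ofReal (Real.exp (t ^ 2 / 2)) := by
    intro t
    rw [← ofReal_integral_eq_lintegral_ofReal (integrable_exp_mul_gaussianReal t)
      (ae_of_all _ fun _ => by positivity)]
    congr 1
    simpa [mgf] using congrFun (mgf_fun_id_gaussianReal (μ := 0) (v := 1)) t
  simp_rw [h1]
  rw [lintegral_pi_prod_eq_prod (gaussianReal 0 1)
    (fun r x => ENNReal.ofReal (Real.exp (a * u r * x))) (fun r => by fun_prop)]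
  simp_rw [h2]
  rw [← ENNReal.ofReal_prod_of_nonneg (fun i _ => by positivity), ← Real.exp_sum,
    Finset.mul_sum, Finset.sum_div]
  simp_rw [mul_pow]

/-- Integrals of `exp` and `cosh` agree under a negation-invariant probability measure. -/
theorem lintegral_exp_eq_one_add_lintegral_cosh {E : Type*} [MeasurableSpace E] [Neg E]
    {μ : Measure E} [IsProbabilityMeasure μ] (hμ : MeasurePreserving (fun x : E => -x) μ μ)
    {f : E → ℝ} (hf : Measurable f) (hodd : ∀ x, f (-x) = -f x) :
    ∫⁻ x, ENNReal.ofReal (Real.exp (f x)) ∂μ =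
      1 + ∫⁻ x, ENNReal.ofReal (Real.cosh (f x) - 1) ∂μ := by
  have hneg : ∫⁻ x, ENNReal.ofReal (Real.exp (-f x)) ∂μ =
      ∫⁻ x, ENNReal.ofReal (Real.exp (f x)) ∂μ := by
    rw [← hμ.lintegral_comp (by fun_prop)]
    simp_rw [hodd, neg_neg]
  have hcosh : 1 + ∫⁻ x, ENNReal.ofReal (Real.cosh (f x) - 1) ∂μ =
      ∫⁻ x, ENNReal.ofReal (Real.cosh (f x)) ∂μ := by
    have h1 : (1 : ENNReal) = ∫⁻ _, 1 ∂μ := by simp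
    rw [h1, ← lintegral_add_left measurable_const]
    refine lintegral_congr fun x => ?_
    rw [← ENNReal.ofReal_one, ← ENNReal.ofReal_add zero_le_one
      (sub_nonneg.2 (Real.one_le_cosh _))]
    congr 1
    ring
  have hsum : 2 * ∫⁻ x, ENNReal.ofReal (Real.cosh (f x)) ∂μ =
      2 * ∫⁻ x, ENNReal.ofReal (Real.exp (f x)) ∂μ := by
    rw [two_mul (∫⁻ x, ENNReal.ofReal (Real.exp (f x)) ∂μ)]
    nth_rw 2 [← hneg]
    rw [← lintegral_add_left (by fun_prop), ← lintegral_const_mul _ (by fun_prop)]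
    refine lintegral_congr fun x => ?_
    rw [← ENNReal.ofReal_add (by positivity) (by positivity), ← ENNReal.ofReal_ofNat 2,
      ← ENNReal.ofReal_mul (by norm_num), Real.cosh_eq]
    congr 1
    ring
  rw [hcosh]
  exact ((ENNReal.mul_right_inj (by norm_num) (by norm_num)).1 hsum).symm

theorem measurePreserving_neg_pi_gaussianReal {ι : Type*} [Fintype ι] :
    MeasurePreserving (fun g : ι → ℝ => -g) (Measure.pi fun _ : ι => gaussianReal 0 1)
      (Measure.pi fun _ : ι => gaussianReal 0 1) :=
  measurePreserving_pi _ _ fun _ =>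
    ⟨measurable_neg, gaussianReal_map_neg.trans (by rw [neg_zero])⟩

theorem lintegral_exp_sq_gaussianReal {q : ℝ} (hq : q < 1) :
    ∫⁻ x, ENNReal.ofReal (Real.exp (q * x ^ 2 / 2)) ∂(gaussianReal 0 1) =
      ENNReal.ofReal (Real.sqrt (1 - q))⁻¹ := by
  have hb : 0 < (1 - q) / 2 := by linarith
  rw [gaussianReal_of_var_ne_zero _ one_ne_zero,
    lintegral_withDensity_eq_lintegral_mul _ (by fun_prop) (by fun_prop)]
  have h : ∀ x : ℝ, (gaussianPDF 0 1 * fun x => ENNReal.ofReal (Real.exp (q * x ^ 2 / 2))) x =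
      ENNReal.ofReal ((Real.sqrt (2 * Real.pi))⁻¹ * Real.exp (-((1 - q) / 2) * x ^ 2)) := by
    intro x
    simp only [Pi.mul_apply, gaussianPDF, gaussianPDFReal]
    rw [← ENNReal.ofReal_mul (by positivity), mul_assoc, ← Real.exp_add]
    simp only [NNReal.coe_one, mul_one, sub_zero]
    congr 3
    ring
  simp_rw [h]
  rw [← ofReal_integral_eq_lintegral_ofReal ((integrable_exp_neg_mul_sq hb).const_mul _)
    (ae_of_all _ fun _ => by positivity), integral_const_mul, integral_gaussian]
  congr 1
  rw [← Real.sqrt_inv, ← Real.sqrt_inv, ← Real.sqrt_mul (by positivity)]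
  congr 1
  have : 1 - q ≠ 0 := by linarith
  field_simp

theorem inv_sqrt_one_sub_le {q : ℝ} (h0 : 0 ≤ q) (h : q ≤ 1 / 2) :
    (Real.sqrt (1 - q))⁻¹ ≤ 1 + q := by
  rw [← Real.sqrt_inv]
  refine Real.sqrt_le_iff.2 ⟨by linarith, ?_⟩
  rw [inv_le_iff_one_le_mul₀ (by linarith)]
  nlinarith [mul_nonneg h0 h0, mul_nonneg h0 (sub_nonneg.2 h)]

theorem lintegral_exp_sq_sum_mul_le {ι : Type*} [Fintype ι] {u : ι → ℝ}
    (hu : ∑ r, u r ^ 2 ≤ 1) {t : ℝ} (ht : t ^ 2 ≤ 1 / 2) :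
    ∫⁻ g, ENNReal.ofReal (Real.exp ((t * ∑ r, u r * g r) ^ 2 / 2))
        ∂(Measure.pi fun _ : ι => gaussianReal 0 1) ≤ ENNReal.ofReal (1 + t ^ 2) := by
  set γ := Measure.pi fun _ : ι => gaussianReal 0 1
  have h1 : ∀ a : ℝ, ENNReal.ofReal (Real.exp (a ^ 2 / 2)) =
      ∫⁻ x, ENNReal.ofReal (Real.exp (a * x)) ∂(gaussianReal 0 1) := by
    intro a
    rw [← ofReal_integral_eq_lintegral_ofReal (integrable_exp_mul_gaussianReal a)
      (ae_of_all _ fun _ => by positivity)]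
    congr 1
    simpa [mgf] using (congrFun (mgf_fun_id_gaussianReal (μ := 0) (v := 1)) a).symm
  calc _ = ∫⁻ g, ∫⁻ x, ENNReal.ofReal (Real.exp ((t * ∑ r, u r * g r) * x))
          ∂(gaussianReal 0 1) ∂γ := by simp_rw [h1]
    _ = ∫⁻ x, ∫⁻ g, ENNReal.ofReal (Real.exp ((t * x) * ∑ r, u r * g r)) ∂γ
          ∂(gaussianReal 0 1) := by
        rw [lintegral_lintegral_swap (by fun_prop)]
        simp_rw [mul_right_comm]
    _ ≤ ∫⁻ x, ENNReal.ofReal (Real.exp (t ^ 2 * x ^ 2 / 2)) ∂(gaussianReal 0 1) := by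
        simp_rw [γ, lintegral_exp_sum_mul_pi_gaussianReal, mul_pow]
        refine lintegral_mono fun x => ENNReal.ofReal_le_ofReal (Real.exp_le_exp.2 ?_)
        gcongr ?_ / 2
        exact mul_le_of_le_one_right (by positivity) hu
    _ = ENNReal.ofReal (Real.sqrt (1 - t ^ 2))⁻¹ :=
        lintegral_exp_sq_gaussianReal (by linarith)
    _ ≤ _ := ENNReal.ofReal_le_ofReal (inv_sqrt_one_sub_le (sq_nonneg t) ht)

theorem lintegral_lintegral_cosh_sum_mul_le {ι κ : Type*} [Fintype ι] [Fintype κ]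
    {u : ι → ℝ} {v : κ → ℝ} (hu : ∑ r, u r ^ 2 ≤ 1) (hv : ∑ r, v r ^ 2 ≤ 1)
    {t : ℝ} (ht : t ^ 2 ≤ 1 / 2) :
    ∫⁻ g, ∫⁻ h, ENNReal.ofReal (Real.cosh (t * (∑ r, u r * g r) * ∑ r, v r * h r) - 1)
        ∂(Measure.pi fun _ : κ => gaussianReal 0 1)
        ∂(Measure.pi fun _ : ι => gaussianReal 0 1) ≤ ENNReal.ofReal (t ^ 2) := by
  set γ := Measure.pi fun _ : ι => gaussianReal 0 1
  have hinner : ∀ a : ℝ, 1 + ∫⁻ h, ENNReal.ofReal (Real.cosh (a * ∑ r, v r * h r) - 1)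
      ∂(Measure.pi fun _ : κ => gaussianReal 0 1) ≤ ENNReal.ofReal (Real.exp (a ^ 2 / 2)) := by
    intro a
    rw [← lintegral_exp_eq_one_add_lintegral_cosh measurePreserving_neg_pi_gaussianReal
      (by fun_prop) (fun h => by simp), lintegral_exp_sum_mul_pi_gaussianReal]
    gcongr
    exact mul_le_of_le_one_right (by positivity) hv
  refine (ENNReal.add_le_add_iff_left ENNReal.one_ne_top).1 ?_
  calc _ = ∫⁻ g, (1 + ∫⁻ h, ENNReal.ofReal
          (Real.cosh (t * (∑ r, u r * g r) * ∑ r, v r * h r) - 1)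
            ∂(Measure.pi fun _ : κ => gaussianReal 0 1)) ∂γ := by
        rw [lintegral_add_left measurable_const]; simp
    _ ≤ ∫⁻ g, ENNReal.ofReal (Real.exp ((t * ∑ r, u r * g r) ^ 2 / 2)) ∂γ :=
        lintegral_mono fun g => hinner _
    _ ≤ ENNReal.ofReal (1 + t ^ 2) := lintegral_exp_sq_sum_mul_le hu ht
    _ = _ := by rw [ENNReal.ofReal_add zero_le_one (sq_nonneg t), ENNReal.ofReal_one]

/-- Exponential moments of a product of two independent coordinates of random unit vectors. -/
theorem lintegral_lintegral_exp_radialNormalize_le {ι : Type*} [Fintype ι] [Nonempty ι]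
    {u v : ι → ℝ} (hu : ∑ r, u r ^ 2 ≤ 1) (hv : ∑ r, v r ^ 2 ≤ 1)
    {t : ℝ} (ht : (4 * t / Fintype.card ι) ^ 2 ≤ 1 / 2) :
    ∫⁻ g, ∫⁻ h, ENNReal.ofReal (Real.exp
          (t * ((∑ r, u r * radialNormalize g r) * ∑ r, v r * radialNormalize h r)))
        ∂(Measure.pi fun _ : ι => gaussianReal 0 1)
        ∂(Measure.pi fun _ : ι => gaussianReal 0 1) ≤
      ENNReal.ofReal (Real.exp (36 * (4 * t / Fintype.card ι) ^ 2)) := by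
  set γ := Measure.pi fun _ : ι => gaussianReal 0 1
  set s := Real.sqrt (Fintype.card ι)
  have hs : s * s = Fintype.card ι := Real.mul_self_sqrt (by positivity)
  calc _ = ∫⁻ g, (1 + ∫⁻ h, ENNReal.ofReal (Real.cosh
          (t * (∑ r, u r * radialNormalize g r) * ∑ r, v r * radialNormalize h r) - 1) ∂γ)
          ∂γ := by
        simp_rw [← mul_assoc]
        refine lintegral_congr fun g => ?_
        exact lintegral_exp_eq_one_add_lintegral_cosh measurePreserving_neg_pi_gaussianReal
          (by fun_prop) (fun h => by simp [radialNormalize_neg])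
    _ = 1 + ∫⁻ g, ∫⁻ h, ENNReal.ofReal (Real.cosh
          (t * (∑ r, u r * radialNormalize g r) * ∑ r, v r * radialNormalize h r) - 1) ∂γ
          ∂γ := by
        rw [lintegral_add_left measurable_const]; simp
    _ ≤ 1 + ∫⁻ g, 6 * ∫⁻ h, ENNReal.ofReal (Real.cosh
          (2 * (t * (∑ r, u r * radialNormalize g r)) / s * ∑ r, v r * h r) - 1) ∂γ ∂γ := by
        gcongr with g
        exact lintegral_cosh_radialNormalize_le hv _
    _ = 1 + 6 * ∫⁻ h, ∫⁻ g, ENNReal.ofReal (Real.cosh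
          (2 * (t * ∑ r, v r * h r) / s * (∑ r, u r * radialNormalize g r)) - 1) ∂γ ∂γ := by
        rw [lintegral_const_mul' _ _ (by norm_num), lintegral_lintegral_swap (by fun_prop)]
        congr! 9
        ring
    _ ≤ 1 + 6 * ∫⁻ h, 6 * ∫⁻ g, ENNReal.ofReal (Real.cosh
          (2 * (2 * (t * ∑ r, v r * h r) / s) / s * (∑ r, u r * g r)) - 1) ∂γ ∂γ := by
        gcongr with h
        exact lintegral_cosh_radialNormalize_le hu _
    _ = 1 + 36 * ∫⁻ h, ∫⁻ g, ENNReal.ofReal (Real.cosh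
          ((4 * t / Fintype.card ι) * (∑ r, v r * h r) * (∑ r, u r * g r)) - 1) ∂γ ∂γ := by
        rw [lintegral_const_mul' _ _ (by norm_num), ← mul_assoc, ← hs]
        norm_num
        congr! 9
        field_simp
        ring
    _ ≤ 1 + 36 * ENNReal.ofReal ((4 * t / Fintype.card ι) ^ 2) := by
        gcongr
        exact lintegral_lintegral_cosh_sum_mul_le hv hu ht
    _ = ENNReal.ofReal (1 + 36 * (4 * t / Fintype.card ι) ^ 2) := by
        rw [ENNReal.ofReal_add zero_le_one (by positivity), ENNReal.ofReal_mul (by norm_num)]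
        simp
    _ ≤ _ := by
        refine ENNReal.ofReal_le_ofReal ?_
        rw [add_comm]
        exact Real.add_one_le_exp _

theorem lintegral_pi_prod_le_pow {δ E : Type*} [Fintype δ] [DecidableEq δ] [MeasurableSpace E]
    (μ : Measure E) [IsProbabilityMeasure μ] {φ : E → E → E → E → ENNReal}
    (hφ : Measurable fun p : E × E × E × E => φ p.1 p.2.1 p.2.2.1 p.2.2.2) {B : ENNReal}
    (hB : ∀ p q, ∫⁻ y, ∫⁻ z, φ p q y z ∂μ ∂μ ≤ B) {i j : δ} {σ : δ → δ} (T : Finset δ)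
    (hinj : Set.InjOn σ T) (hσT : ∀ a ∈ T, σ a ∉ T) (hi : i ∉ T) (hj : j ∉ T)
    (hσi : ∀ a ∈ T, σ a ≠ i) (hσj : ∀ a ∈ T, σ a ≠ j) :
    ∫⁻ x, ∏ a ∈ T, φ (x i) (x j) (x (σ a)) (x a) ∂(Measure.pi fun _ : δ => μ) ≤
      B ^ T.card := by
  have hm : ∀ a, Measurable fun x : δ → E => φ (x i) (x j) (x (σ a)) (x a) := fun a =>
    hφ.comp (by fun_prop : Measurable fun x : δ → E => (x i, x j, x (σ a), x a))
  induction T using Finset.induction_on with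
  | empty => simp
  | insert a T ha ih =>
    have hmT : Measurable fun x : δ → E => ∏ b ∈ T, φ (x i) (x j) (x (σ b)) (x b) :=
      Finset.measurable_prod _ fun b _ => hm b
    have hTs : ∀ b ∈ T, b ∈ insert a T := fun b hb => Finset.mem_insert_of_mem hb
    have haa : a ∈ insert a T := Finset.mem_insert_self a T
    specialize ih (hinj.mono (by exact_mod_cast Finset.subset_insert a T))
      (fun b hb h => hσT b (hTs b hb) (hTs _ h)) (fun h => hi (hTs _ h)) (fun h => hj (hTs _ h))
      (fun b hb => hσi b (hTs b hb)) (fun b hb => hσj b (hTs b hb))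
    have hσa : σ a ≠ a := fun h => hσT a haa (h.symm ▸ haa)
    have hia : i ≠ a := fun h => hi (h ▸ haa)
    have hja : j ≠ a := fun h => hj (h ▸ haa)
    calc ∫⁻ x, ∏ b ∈ insert a T, φ (x i) (x j) (x (σ b)) (x b) ∂(Measure.pi fun _ : δ => μ)
        = ∫⁻ x, φ (x i) (x j) (x (σ a)) (x a) * ∏ b ∈ T, φ (x i) (x j) (x (σ b)) (x b)
            ∂(Measure.pi fun _ : δ => μ) := by simp_rw [Finset.prod_insert ha]
      _ ≤ ∫⁻ x, B * ∏ b ∈ T, φ (x i) (x j) (x (σ b)) (x b)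
            ∂(Measure.pi fun _ : δ => μ) := by
          have hmaT : Measurable fun x : δ → E =>
              φ (x i) (x j) (x (σ a)) (x a) * ∏ b ∈ T, φ (x i) (x j) (x (σ b)) (x b) :=
            (hm a).mul hmT
          refine lintegral_le_of_lmarginal_le {σ a, a} hmaT (hmT.const_mul B) ?_
          intro x
          have hnot : σ a ∉ ({a} : Finset δ) := by simpa using hσa
          rw [lmarginal_insert _ hmaT hnot, lmarginal_insert _ (hmT.const_mul B) hnot,
            lmarginal_singleton, lmarginal_singleton]
          have hrest : ∀ y z, ∏ b ∈ T, φ (Function.update (Function.update x (σ a) y) a z i)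
              (Function.update (Function.update x (σ a) y) a z j)
              (Function.update (Function.update x (σ a) y) a z (σ b))
              (Function.update (Function.update x (σ a) y) a z b) =
              ∏ b ∈ T, φ (x i) (x j) (x (σ b)) (x b) := by
            intro y z
            refine Finset.prod_congr rfl fun b hb => ?_
            have h1 : b ≠ a := fun h => ha (h ▸ hb)
            have h2 : b ≠ σ a := fun h => hσT a haa (h ▸ hTs b hb)
            have h3 : σ b ≠ a := fun h => hσT b (hTs b hb) (h ▸ haa)
            have h4 : σ b ≠ σ a := fun h => h1 (hinj (hTs b hb) haa h)
            simp [h1, h2, h3, h4, hia, hja, (hσi a haa).symm, (hσj a haa).symm]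
          simp only [hrest]
          simp only [Function.update_self, Function.update_of_ne hia, Function.update_of_ne hja,
            Function.update_of_ne hσa, Function.update_of_ne (hσi a haa).symm,
            Function.update_of_ne (hσj a haa).symm]
          have hm2 : Measurable fun p : E × E => φ (x i) (x j) p.1 p.2 :=
            hφ.comp (by fun_prop : Measurable fun p : E × E => (x i, x j, p.1, p.2))
          have hm1 : ∀ y, Measurable fun z => φ (x i) (x j) y z := fun y =>
            hm2.comp measurable_prodMk_left
          simp_rw [fun y => lintegral_mul_const (μ := μ)
            (∏ b ∈ T, φ (x i) (x j) (x (σ b)) (x b)) (hm1 y)]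
          rw [lintegral_mul_const _ hm2.lintegral_prod_right']
          simp only [lintegral_const, measure_univ, mul_one]
          gcongr
          exact hB _ _
      _ ≤ B ^ (insert a T).card := by
          rw [lintegral_const_mul _ hmT, Finset.card_insert_of_notMem ha, pow_succ']
          gcongr

theorem measure_lt_le_of_lintegral_exp_le {Ω : Type*} [MeasurableSpace Ω] {μ : Measure Ω}
    {f : Ω → ℝ} (hf : Measurable f) {t b : ℝ} (ht : 0 ≤ t)
    (h : ∫⁻ ω, ENNReal.ofReal (Real.exp (t * f ω)) ∂μ ≤ ENNReal.ofReal (Real.exp b)) (s : ℝ) :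
    μ {ω | s < f ω} ≤ ENNReal.ofReal (Real.exp (b - t * s)) := by
  have hpos : 0 < Real.exp (t * s) := Real.exp_pos _
  calc μ {ω | s < f ω}
      ≤ μ {ω | ENNReal.ofReal (Real.exp (t * s)) ≤ ENNReal.ofReal (Real.exp (t * f ω))} := by
        refine measure_mono fun ω hω => ENNReal.ofReal_le_ofReal (Real.exp_le_exp.2 ?_)
        exact mul_le_mul_of_nonneg_left (le_of_lt hω) ht
    _ ≤ (∫⁻ ω, ENNReal.ofReal (Real.exp (t * f ω)) ∂μ) / ENNReal.ofReal (Real.exp (t * s)) :=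
        meas_ge_le_lintegral_div (by fun_prop) (by simp [Real.exp_pos]) (by finiteness)
    _ ≤ ENNReal.ofReal (Real.exp b) / ENNReal.ofReal (Real.exp (t * s)) := by gcongr
    _ = _ := by rw [← ENNReal.ofReal_div_of_pos hpos, Real.exp_sub]

/-- The cross-correlation sum, with `x` a family of vectors. -/
noncomputable def crossCorrelation {m d : ℕ} (i j : Fin m) (T : Finset (Fin m))
    (σ : Fin m → Fin m) (x : Fin m → Fin d → ℝ) : ℝ :=
  ∑ a ∈ T, (∑ r, x i r * x (σ a) r) * (∑ r, x j r * x a r)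

theorem measurable_crossCorrelation {m d : ℕ} (i j : Fin m) (T : Finset (Fin m))
    (σ : Fin m → Fin m) : Measurable (crossCorrelation (d := d) i j T σ) := by
  unfold crossCorrelation
  fun_prop

theorem lintegral_exp_crossCorrelation_le {m d : ℕ} (hd : 0 < d) {i j : Fin m}
    {T : Finset (Fin m)} {σ : Fin m → Fin m} (hcard : T.card ≤ d)
    (hinj : Set.InjOn σ T) (hσT : ∀ a ∈ T, σ a ∉ T) (hi : i ∉ T) (hj : j ∉ T)
    (hσi : ∀ a ∈ T, σ a ≠ i) (hσj : ∀ a ∈ T, σ a ≠ j) {t : ℝ}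
    (ht : (4 * t / d) ^ 2 ≤ 1 / 2) :
    ∫⁻ x, ENNReal.ofReal (Real.exp (t * crossCorrelation i j T σ x))
        ∂(Measure.pi fun _ : Fin m => uniformSphere d) ≤
      ENNReal.ofReal (Real.exp (576 * t ^ 2 / d)) := by
  have : Nonempty (Fin d) := ⟨⟨0, hd⟩⟩
  have hprob : IsProbabilityMeasure
      ((Measure.pi fun _ : Fin d => gaussianReal 0 1).map radialNormalize) :=
    Measure.isProbabilityMeasure_map (by fun_prop)
  have hpi : (Measure.pi fun _ : Fin m => uniformSphere d) =
      (Measure.pi fun _ : Fin m => Measure.pi fun _ : Fin d => gaussianReal 0 1).map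
        fun x k => radialNormalize (x k) :=
    (Measure.pi_map_pi fun _ => by fun_prop).symm
  have hmeas := measurable_crossCorrelation (d := d) i j T σ
  rw [hpi, lintegral_map (by fun_prop) (by fun_prop)]
  have hprod : ∀ x : Fin m → Fin d → ℝ, ENNReal.ofReal (Real.exp
      (t * crossCorrelation i j T σ fun k => radialNormalize (x k))) =
      ∏ a ∈ T, ENNReal.ofReal (Real.exp (t *
        ((∑ r, radialNormalize (x i) r * radialNormalize (x (σ a)) r) *
          ∑ r, radialNormalize (x j) r * radialNormalize (x a) r))) := by
    intro x
    rw [← ENNReal.ofReal_prod_of_nonneg (fun i _ => by positivity), ← Real.exp_sum,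
      ← Finset.mul_sum, crossCorrelation]
  simp_rw [hprod]
  refine (lintegral_pi_prod_le_pow (Measure.pi fun _ : Fin d => gaussianReal 0 1)
    (φ := fun p q y z => ENNReal.ofReal (Real.exp (t *
        ((∑ r, radialNormalize p r * radialNormalize y r) *
          ∑ r, radialNormalize q r * radialNormalize z r)))) (by fun_prop)
    (B := ENNReal.ofReal (Real.exp (36 * (4 * t / d) ^ 2)))
    (fun p q => ?_) T hinj hσT hi hj hσi hσj).trans ?_
  · simpa using lintegral_lintegral_exp_radialNormalize_le (sum_sq_radialNormalize_le_one p)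
      (sum_sq_radialNormalize_le_one q) (t := t) (by simpa using ht)
  · rw [← ENNReal.ofReal_pow (by positivity), ← Real.exp_nat_mul]
    refine ENNReal.ofReal_le_ofReal (Real.exp_le_exp.2 ?_)
    have hd' : (0 : ℝ) < d := by exact_mod_cast hd
    calc (T.card : ℝ) * (36 * (4 * t / d) ^ 2) ≤ d * (36 * (4 * t / d) ^ 2) := by
          gcongr
      _ = 576 * t ^ 2 / d := by field_simp; ring


/-- **Cross-correlation concentration for random spherical codes.**
There are absolute constants `C₃, c₀ > 0` such that for `m ≥ 2`, `d ≥ c₀·log m`, i.i.d.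
uniform unit-sphere vectors `x_1,…,x_m ⊂ ℝ^d`, fixed indices `i, j`, a set `T` with
`|T| ≤ d` and an injection `σ` on `T` with `σ(T) ∩ T = ∅` and `i, j ∉ T ∪ σ(T)`,
`P[ |Σ_{a∈T} ⟨x_i, x_{σ(a)}⟩·⟨x_j, x_a⟩| > C₃·√(log m / d) ] ≤ 2·m⁻⁶`. -/
theorem stmt_19 :
    ∃ C₃ > (0 : ℝ), ∃ c₀ > (0 : ℝ),
      ∀ m d : ℕ, 2 ≤ m → c₀ * Real.log m ≤ d →
      ∀ {Ω : Type} [MeasurableSpace Ω] (P : Measure Ω), IsProbabilityMeasure P →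
      ∀ x : Fin m → Ω → (Fin d → ℝ),
        (∀ i, Measurable (x i)) →
        (∀ i, Measure.map (x i) P = uniformSphere d) →
        iIndepFun x P →
      ∀ (i j : Fin m) (T : Finset (Fin m)) (σ : Fin m → Fin m),
        T.card ≤ d →
        Set.InjOn σ T →
        (∀ a ∈ T, σ a ∉ T) →
        i ∉ T → j ∉ T → (∀ a ∈ T, σ a ≠ i) → (∀ a ∈ T, σ a ≠ j) →
        P {ω | C₃ * Real.sqrt (Real.log m / d) <
            |∑ a ∈ T, (∑ r, x i ω r * x (σ a) ω r) * (∑ r, x j ω r * x a ω r)|}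
          ≤ 2 * ((m : ENNReal) ^ 6)⁻¹ := by
  refine ⟨582, by norm_num, 32, by norm_num, ?_⟩
  intro m d hm hmd Ω _ P hP x hx hlaw hindep i j T σ hcard hinj hσT hi hj hσi hσj
  have hm' : (2 : ℝ) ≤ m := by exact_mod_cast hm
  have hlog : 0 < Real.log m := Real.log_pos (by linarith)
  have hd' : (0 : ℝ) < d := by linarith
  have hd : 0 < d := by exact_mod_cast hd'
  have hmap : P.map (fun ω k => x k ω) = Measure.pi fun _ : Fin m => uniformSphere d := by
    rw [(iIndepFun_iff_map_fun_eq_pi_map fun k => (hx k).aemeasurable).1 hindep]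
    simp_rw [hlaw]
  have hmeas := measurable_crossCorrelation (d := d) i j T σ
  have hmgf : ∀ t : ℝ, (4 * t / d) ^ 2 ≤ 1 / 2 →
      ∫⁻ ω, ENNReal.ofReal (Real.exp (t * crossCorrelation i j T σ fun k => x k ω)) ∂P ≤
        ENNReal.ofReal (Real.exp (576 * t ^ 2 / d)) := by
    intro t ht
    refine le_of_eq_of_le ?_
      (lintegral_exp_crossCorrelation_le hd hcard hinj hσT hi hj hσi hσj ht)
    rw [← hmap, lintegral_map (by fun_prop) (by fun_prop)]
  set L := Real.log m with hL
  set t := Real.sqrt (d * L) with ht_def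
  have ht0 : 0 ≤ t := Real.sqrt_nonneg _
  have htsq : t ^ 2 = d * L := Real.sq_sqrt (by positivity)
  have ht : (4 * t / d) ^ 2 ≤ 1 / 2 := by
    rw [div_pow, mul_pow, htsq, div_le_iff₀ (by positivity)]
    nlinarith
  have hts : t * Real.sqrt (L / d) = L := by
    rw [ht_def, ← Real.sqrt_mul (by positivity), ← Real.sqrt_sq hlog.le]
    congr 1
    rw [Real.sqrt_sq hlog.le]
    field_simp
  have hexp : 576 * t ^ 2 / d - t * (582 * Real.sqrt (L / d)) = -(6 * L) := by
    rw [htsq, mul_left_comm t, hts]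
    field_simp
    ring
  have htail : ENNReal.ofReal (Real.exp (-(6 * L))) = ((m : ENNReal) ^ 6)⁻¹ := by
    have h6 : Real.exp (6 * L) = (m : ℝ) ^ 6 := by
      rw [show (6 : ℝ) = ((6 : ℕ) : ℝ) by norm_num, Real.exp_nat_mul, hL,
        Real.exp_log (by linarith)]
    rw [Real.exp_neg, h6, ENNReal.ofReal_inv_of_pos (by positivity),
      ENNReal.ofReal_pow (by positivity), ENNReal.ofReal_natCast]
  have hX : Measurable fun ω => crossCorrelation i j T σ fun k => x k ω := by fun_prop
  have hupper := measure_lt_le_of_lintegral_exp_le hX ht0 (hmgf t ht) (582 * Real.sqrt (L / d))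
  have hlower := measure_lt_le_of_lintegral_exp_le hX.neg ht0 (b := 576 * t ^ 2 / d)
    (μ := P) (by
      have h := hmgf (-t) (by simpa [neg_div] using ht)
      rw [neg_sq] at h
      simpa using h) (582 * Real.sqrt (L / d))
  rw [hexp, htail] at hupper hlower
  calc P {ω | 582 * Real.sqrt (L / d) < |crossCorrelation i j T σ fun k => x k ω|}
      ≤ P ({ω | 582 * Real.sqrt (L / d) < crossCorrelation i j T σ fun k => x k ω} ∪
        {ω | 582 * Real.sqrt (L / d) < -crossCorrelation i j T σ fun k => x k ω}) :=
        measure_mono fun ω hω => by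
          simpa only [Set.mem_union, Set.mem_ofPred_eq, lt_abs] using hω
    _ ≤ _ := measure_union_le _ _
    _ ≤ ((m : ENNReal) ^ 6)⁻¹ + ((m : ENNReal) ^ 6)⁻¹ := add_le_add hupper hlower
    _ = _ := (two_mul _).symm
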